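/- Let y be a von Mises–Fisher random vector on S_p with parameters (κ_y, μ_y) and let z be uniformly distributed on S_p. Then the Kullback–Leibler divergence of y from z equals d_ℓ(y,z) = ν·ln(κ_y/2) − ln(I_ν(κ_y)) − ln(Γ(ν+1)) + r_ν(κ_y)·κ_y, where r_ν(κ) = I_{ν+1}(κ)/I_ν(κ). -/

import Mathlib

open MeasureTheory Real
open scoped RealInnerProductSpace

/-- `ν = p/2 − 1`. -/
noncomputable def nuOf (p : ℕ) : ℝ := (p : ℝ) / 2 - 1

/-- The modified Bessel function of the first kind,
`I_ν(z) = (z/2)^ν ∑_{k=0}^∞ (z/2)^{2k}/(k!·Γ(ν+k+1))`. -/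
noncomputable def besselI (ν z : ℝ) : ℝ :=
  (z / 2) ^ ν * ∑' k : ℕ, (z / 2) ^ (2 * k) / (Nat.factorial k * Real.Gamma (ν + k + 1))

/-- The ratio of modified Bessel functions `r_ν(κ) = I_{ν+1}(κ)/I_ν(κ)`. -/
noncomputable def besselRatio (ν κ : ℝ) : ℝ := besselI (ν + 1) κ / besselI ν κ

/-- The standard surface measure on the unit sphere in `ℝ^p`. -/
noncomputable def sphereMeasure (p : ℕ) :
    Measure (Metric.sphere (0 : EuclideanSpace ℝ (Fin p)) 1) :=
  (volume : Measure (EuclideanSpace ℝ (Fin p))).toSphere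

/-- The von Mises–Fisher partition function `C_ν(κ) = (2π)^{ν+1} I_ν(κ)/κ^ν`. -/
noncomputable def vmfC (ν κ : ℝ) : ℝ := (2 * Real.pi) ^ (ν + 1) * besselI ν κ / κ ^ ν

/-- The von Mises–Fisher density `f_p(x;κ,μ) = exp(κ⟨μ,x⟩)/C_ν(κ)`. -/
noncomputable def vmf (p : ℕ) (κ : ℝ) (μ x : EuclideanSpace ℝ (Fin p)) : ℝ :=
  Real.exp (κ * ⟪μ, x⟫) / vmfC (nuOf p) κ

/-- The uniform density on the unit sphere in `ℝ^p`, `u(x) = Γ(ν+1)/(2π^{ν+1})`. -/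
noncomputable def uniformDensity (p : ℕ) : ℝ :=
  Real.Gamma (nuOf p + 1) / (2 * Real.pi ^ (nuOf p + 1))

/-- The Kullback–Leibler divergence of `f_p(·;κ_y,μ_y)` from the uniform
distribution on the sphere. -/
noncomputable def klDivUniform (p : ℕ) (κy : ℝ) (μy : EuclideanSpace ℝ (Fin p)) : ℝ :=
  ∫ x : Metric.sphere (0 : EuclideanSpace ℝ (Fin p)) 1,
    Real.log (vmf p κy μy (x : EuclideanSpace ℝ (Fin p)) / uniformDensity p)
      * vmf p κy μy (x : EuclideanSpace ℝ (Fin p)) ∂(sphereMeasure p)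


lemma aux_finite (p : ℕ) : IsFiniteMeasure (sphereMeasure p) := by
  unfold sphereMeasure; infer_instance

lemma aux_polar (q n : ℕ) (μ : EuclideanSpace ℝ (Fin (q+1))) :
    ∫ x : EuclideanSpace ℝ (Fin (q+1)), ⟪μ, x⟫ ^ n * Real.exp (-‖x‖ ^ 2)
      = (∫ s : Metric.sphere (0 : EuclideanSpace ℝ (Fin (q+1))) 1,
          ⟪μ, (s : EuclideanSpace ℝ (Fin (q+1)))⟫ ^ n ∂(sphereMeasure (q+1)))
        * ∫ r in Set.Ioi (0:ℝ), r ^ q * (r ^ n * Real.exp (-r ^ 2)) := by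
  have hfin := aux_finite (q+1)
  have hd : Module.finrank ℝ (EuclideanSpace ℝ (Fin (q+1))) - 1 = q := by simp
  have h2 := (volume : Measure (EuclideanSpace ℝ (Fin (q+1)))).measurePreserving_homeomorphUnitSphereProd.integral_comp
        (Homeomorph.measurableEmbedding _)
        (fun z => ⟪μ, (z.1 : EuclideanSpace ℝ (Fin (q+1)))⟫ ^ n *
          ((z.2 : ℝ) ^ n * Real.exp (-(z.2 : ℝ) ^ 2)))
  have h3 := integral_prod_mul (μ := sphereMeasure (q+1)) (ν := Measure.volumeIoiPow q)
    (fun s => ⟪μ, (s : EuclideanSpace ℝ (Fin (q+1)))⟫ ^ n)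
    (fun r => ((r : ℝ) ^ n * Real.exp (-(r : ℝ) ^ 2)))
  rw [hd] at h2
  calc
    _ = ∫ x : ({(0)}ᶜ : Set (EuclideanSpace ℝ (Fin (q+1)))), ⟪μ, x.1⟫ ^ n * Real.exp (-‖x.1‖ ^ 2) ∂(Measure.comap Subtype.val volume) := by
      rw [integral_subtype_comap (measurableSet_singleton _).compl
        fun x : EuclideanSpace ℝ (Fin (q+1)) ↦ ⟪μ, x⟫ ^ n * Real.exp (-‖x‖ ^ 2),
        restrict_compl_singleton]
    _ = _ := by
      refine Eq.trans (integral_congr_ae (Filter.Eventually.of_forall fun x => ?_)) (h2.trans ?_)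
      · have hx : ‖x.1‖ ≠ 0 := norm_ne_zero_iff.2 x.2
        simp only [homeomorphUnitSphereProd_apply_fst_coe, homeomorphUnitSphereProd_apply_snd_coe,
          inner_smul_right, mul_pow, inv_pow]
        field_simp
      refine h3.trans ?_
      congr 1
      simp only [Measure.volumeIoiPow, ENNReal.ofReal]
      rw [integral_withDensity_eq_integral_smul,
        integral_subtype_comap measurableSet_Ioi fun a : ℝ ↦
          Real.toNNReal (a ^ q) • (a ^ n * Real.exp (-a ^ 2)),
        setIntegral_congr_fun measurableSet_Ioi fun x hx ↦ ?_]
      · rw [NNReal.smul_def, Real.coe_toNNReal _ (pow_nonneg hx.out.le _), smul_eq_mul]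
      · exact (measurable_subtype_coe.pow_const _).real_toNNReal

lemma aux_gauss (q n : ℕ) (μ : EuclideanSpace ℝ (Fin (q+1))) (hμ : ‖μ‖ = 1) :
    ∫ x : EuclideanSpace ℝ (Fin (q+1)), ⟪μ, x⟫ ^ n * Real.exp (-‖x‖ ^ 2)
      = (∫ t : ℝ, t ^ n * Real.exp (-t ^ 2)) * (√π) ^ q := by
  obtain ⟨b, hb⟩ := Orthonormal.exists_orthonormalBasis_extension_of_card_eq (𝕜 := ℝ)
    (E := EuclideanSpace ℝ (Fin (q+1))) (ι := Fin (q+1)) (by simp) (v := fun _ => μ) (s := {0})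
    (by
      constructor
      · intro i; simpa using hμ
      · intro i j hij; exact absurd (Subsingleton.elim i j) hij)
  have hb0 : b 0 = μ := hb 0 rfl
  rw [← b.measurePreserving_repr_symm.integral_comp
    b.repr.symm.toHomeomorph.measurableEmbedding]
  rw [← (PiLp.volume_preserving_toLp (Fin (q+1))).integral_comp
    (MeasurableEquiv.toLp 2 _).measurableEmbedding]
  have key : ∀ x : Fin (q+1) → ℝ, ⟪μ, b.repr.symm (WithLp.toLp 2 x)⟫ ^ n
      * Real.exp (-‖b.repr.symm (WithLp.toLp 2 x)‖ ^ 2)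
      = ∏ i, (if i = 0 then (x i) ^ n * Real.exp (-(x i) ^ 2) else Real.exp (-(x i) ^ 2)) := by
    intro x
    have h1 : ⟪μ, b.repr.symm (WithLp.toLp 2 x)⟫ = x 0 := by
      rw [← hb0, ← b.repr_apply_apply]; simp
    rw [h1, LinearIsometryEquiv.norm_map, EuclideanSpace.norm_sq_eq, ← Finset.sum_neg_distrib,
      Real.exp_sum, Fin.prod_univ_succ, Fin.prod_univ_succ]
    simp [Fin.succ_ne_zero, mul_assoc]
  simp only [key]
  rw [integral_fintype_prod_volume_eq_prod (f := fun (i : Fin (q+1)) (t : ℝ) =>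
    (if i = 0 then t ^ n * Real.exp (-t ^ 2) else Real.exp (-t ^ 2))), Fin.prod_univ_succ]
  have := integral_gaussian 1
  simp only [neg_mul, one_mul, div_one] at this
  simp [Fin.succ_ne_zero, this]

lemma aux_Ioi (n : ℕ) : ∫ r in Set.Ioi (0:ℝ), r ^ n * Real.exp (-r ^ 2)
    = (1/2) * Real.Gamma ((n + 1) / 2) := by
  have := integral_rpow_mul_exp_neg_rpow (p := 2) (q := n) (by norm_num)
    (by have : (0:ℝ) ≤ n := n.cast_nonneg
        linarith)
  rw [← this]
  refine setIntegral_congr_fun measurableSet_Ioi fun x hx => ?_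
  simp

lemma aux_even (k : ℕ) : ∫ t : ℝ, t ^ (2*k) * Real.exp (-t ^ 2) = Real.Gamma (k + 1/2) := by
  have := integral_comp_abs (f := fun t => t ^ (2*k) * Real.exp (-t ^ 2))
  rw [aux_Ioi] at this
  simp only [pow_mul, sq_abs] at this ⊢
  rw [this]
  push_cast
  rw [show ((2 * (k:ℝ) + 1) / 2) = k + 1/2 by ring]
  ring

lemma aux_odd (k : ℕ) : ∫ t : ℝ, t ^ (2*k+1) * Real.exp (-t ^ 2) = 0 := by
  have h := integral_neg_eq_self (fun t : ℝ => t ^ (2*k+1) * Real.exp (-t ^ 2)) volume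
  have h2 : ∀ t : ℝ, (-t) ^ (2*k+1) * Real.exp (-(-t) ^ 2) = - (t ^ (2*k+1) * Real.exp (-t ^ 2)) := by
    intro t
    rw [Odd.neg_pow ⟨k, rfl⟩, neg_sq]; ring
  simp only [h2, integral_neg] at h
  linarith

lemma aux_gammaHalf (k : ℕ) :
    Real.Gamma (k + 1/2) = (2*k).factorial * √π / (4 ^ k * k.factorial) := by
  induction k with
  | zero => rw [Nat.cast_zero, zero_add, Real.Gamma_one_half_eq]; simp
  | succ k ih =>
    rw [show ((k+1 : ℕ) : ℝ) + 1/2 = (k + 1/2) + 1 by push_cast; ring,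
      Real.Gamma_add_one (by positivity), ih, show 2 * (k+1) = (2*k+1)+1 by ring,
      Nat.factorial_succ, Nat.factorial_succ, Nat.factorial_succ]
    push_cast
    field_simp
    ring

lemma aux_Modd (q k : ℕ) (μ : EuclideanSpace ℝ (Fin (q+1))) (hμ : ‖μ‖ = 1) :
    ∫ s : Metric.sphere (0 : EuclideanSpace ℝ (Fin (q+1))) 1,
          ⟪μ, (s : EuclideanSpace ℝ (Fin (q+1)))⟫ ^ (2*k+1) ∂(sphereMeasure (q+1)) = 0 := by
  have h := aux_polar q (2*k+1) μ
  rw [aux_gauss q _ μ hμ, aux_odd] at h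
  simp only [← mul_assoc, ← pow_add, aux_Ioi] at h
  have hG : 0 < Real.Gamma ((((q + (2*k+1) : ℕ) : ℝ) + 1)/2) := Real.Gamma_pos_of_pos (by positivity)
  rw [zero_mul, eq_comm, mul_eq_zero] at h
  rcases h with h | h
  · linarith
  · exfalso; linarith

lemma aux_Meven (q k : ℕ) (μ : EuclideanSpace ℝ (Fin (q+1))) (hμ : ‖μ‖ = 1) :
    ∫ s : Metric.sphere (0 : EuclideanSpace ℝ (Fin (q+1))) 1,
          ⟪μ, (s : EuclideanSpace ℝ (Fin (q+1)))⟫ ^ (2*k) ∂(sphereMeasure (q+1))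
      = 2 * π ^ (nuOf (q+1) + 1) * (2*k).factorial /
        (4 ^ k * k.factorial * Real.Gamma (nuOf (q+1) + k + 1)) := by
  have h := aux_polar q (2*k) μ
  rw [aux_gauss q _ μ hμ, aux_even, aux_gammaHalf] at h
  simp only [← mul_assoc, ← pow_add, aux_Ioi] at h
  have e : (((q + 2*k : ℕ) : ℝ) + 1)/2 = nuOf (q+1) + k + 1 := by
    unfold nuOf; push_cast; ring
  rw [e] at h
  have hG : 0 < Real.Gamma (nuOf (q+1) + k + 1) :=
    Real.Gamma_pos_of_pos (by rw [← e]; positivity)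
  have hpi : π ^ (nuOf (q+1) + 1) = √π * √π ^ q := by
    rw [← pow_succ', Real.sqrt_eq_rpow, ← Real.rpow_natCast, ← Real.rpow_mul pi_pos.le]
    congr 1
    unfold nuOf; push_cast; ring
  rw [hpi, eq_div_iff (by positivity)]
  field_simp at h
  linarith

lemma aux_abs_le (p : ℕ) (μ : EuclideanSpace ℝ (Fin p)) (hμ : ‖μ‖ = 1)
    (s : Metric.sphere (0 : EuclideanSpace ℝ (Fin p)) 1) :
    |⟪μ, (s : EuclideanSpace ℝ (Fin p))⟫| ≤ 1 := by
  have h := abs_real_inner_le_norm μ (s : EuclideanSpace ℝ (Fin p))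
  have hs : ‖(s : EuclideanSpace ℝ (Fin p))‖ = 1 := by simp
  rwa [hμ, hs, one_mul] at h

lemma aux_hasSum (p m : ℕ) (κ : ℝ) (μ : EuclideanSpace ℝ (Fin p)) (hμ : ‖μ‖ = 1) :
    HasSum (fun n : ℕ => κ ^ n / n.factorial *
      ∫ s : Metric.sphere (0 : EuclideanSpace ℝ (Fin p)) 1,
          ⟪μ, (s : EuclideanSpace ℝ (Fin p))⟫ ^ (n + m) ∂(sphereMeasure p))
      (∫ s : Metric.sphere (0 : EuclideanSpace ℝ (Fin p)) 1,
          ⟪μ, (s : EuclideanSpace ℝ (Fin p))⟫ ^ m *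
            Real.exp (κ * ⟪μ, (s : EuclideanSpace ℝ (Fin p))⟫) ∂(sphereMeasure p)) := by
  have hfin := aux_finite p
  simp only [← integral_const_mul]
  refine hasSum_integral_of_dominated_convergence (fun n _ => |κ| ^ n / n.factorial) ?_ ?_ ?_ ?_ ?_
  · intro n
    exact Continuous.aestronglyMeasurable (by fun_prop)
  · intro n
    refine Filter.Eventually.of_forall fun s => ?_
    rw [norm_mul, norm_div, norm_pow, norm_pow, Real.norm_eq_abs, Real.norm_eq_abs, Real.norm_eq_abs,
      Nat.abs_cast]
    exact mul_le_of_le_one_right (by positivity)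
      (pow_le_one₀ (abs_nonneg _) (aux_abs_le p μ hμ s))
  · exact Filter.Eventually.of_forall fun s => Real.summable_pow_div_factorial _
  · exact integrable_const _
  · refine Filter.Eventually.of_forall fun s => ?_
    have h0 := NormedSpace.expSeries_div_hasSum_exp (𝔸 := ℝ) (κ * ⟪μ, (s : EuclideanSpace ℝ (Fin p))⟫)
    rw [← Real.exp_eq_exp_ℝ] at h0
    have h := h0.mul_left
      (⟪μ, (s : EuclideanSpace ℝ (Fin p))⟫ ^ m)
    refine Eq.mp (congrArg (fun g => HasSum g _) (funext fun n => ?_)) h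
    rw [pow_add, mul_pow]; ring

lemma aux_nu_pos (q k : ℕ) : 0 < nuOf (q+1) + k + 1 := by
  have : nuOf (q+1) + k + 1 = ((q:ℝ) + 1)/2 + k := by unfold nuOf; push_cast; ring
  rw [this]; positivity

lemma aux_Z (q : ℕ) (κ : ℝ) (μ : EuclideanSpace ℝ (Fin (q+1))) (hμ : ‖μ‖ = 1) :
    HasSum (fun k : ℕ => (κ / 2) ^ (2 * k) /
        (Nat.factorial k * Real.Gamma (nuOf (q+1) + k + 1)) * (2 * π ^ (nuOf (q+1) + 1)))
      (∫ s : Metric.sphere (0 : EuclideanSpace ℝ (Fin (q+1))) 1,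
            Real.exp (κ * ⟪μ, (s : EuclideanSpace ℝ (Fin (q+1)))⟫) ∂(sphereMeasure (q+1))) := by
  have h := aux_hasSum (q+1) 0 κ μ hμ
  simp only [pow_zero, one_mul, add_zero] at h
  have hinj : Function.Injective (fun k : ℕ => 2 * k) := fun a b hab => by
    simpa using hab
  rw [← hinj.hasSum_iff] at h
  · convert h using 2 with k
    have hG : 0 < Real.Gamma (nuOf (q+1) + k + 1) := Real.Gamma_pos_of_pos (aux_nu_pos q k)
    simp only [Function.comp]
    rw [aux_Meven q k μ hμ, div_pow, pow_mul 2 2 k]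
    norm_num
    field_simp
  · intro n hn
    rcases Nat.even_or_odd' n with ⟨k, rfl | rfl⟩
    · exact absurd ⟨k, rfl⟩ hn
    · rw [aux_Modd q k μ hμ, mul_zero]

lemma aux_W (q : ℕ) (κ : ℝ) (μ : EuclideanSpace ℝ (Fin (q+1))) (hμ : ‖μ‖ = 1) :
    HasSum (fun k : ℕ => (κ / 2) ^ (2 * k) /
        (Nat.factorial k * Real.Gamma (nuOf (q+1) + 1 + k + 1)) *
          (2 * π ^ (nuOf (q+1) + 1) * (κ / 2)))
      (∫ s : Metric.sphere (0 : EuclideanSpace ℝ (Fin (q+1))) 1,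
            ⟪μ, (s : EuclideanSpace ℝ (Fin (q+1)))⟫ *
            Real.exp (κ * ⟪μ, (s : EuclideanSpace ℝ (Fin (q+1)))⟫) ∂(sphereMeasure (q+1))) := by
  have h := aux_hasSum (q+1) 1 κ μ hμ
  simp only [pow_one] at h
  have hinj : Function.Injective (fun k : ℕ => 2 * k + 1) := fun a b hab => by
    simpa using hab
  rw [← hinj.hasSum_iff] at h
  · convert h using 2 with k
    have e : nuOf (q+1) + 1 + k + 1 = nuOf (q+1) + (k+1 : ℕ) + 1 := by push_cast; ring
    have hG : 0 < Real.Gamma (nuOf (q+1) + (k+1 : ℕ) + 1) :=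
      Real.Gamma_pos_of_pos (aux_nu_pos q (k+1))
    simp only [Function.comp]
    rw [show 2 * k + 1 + 1 = 2 * (k+1) by ring, aux_Meven q (k+1) μ hμ, e]
    set G := Real.Gamma (nuOf (q+1) + (k+1 : ℕ) + 1)
    rw [show 2 * (k+1) = (2*k+1)+1 by ring, Nat.factorial_succ (2*k+1), Nat.factorial_succ k,
      div_pow, pow_mul 2 2 k]
    push_cast
    norm_num
    field_simp
    ring
  · intro n hn
    rcases Nat.even_or_odd' n with ⟨k, rfl | rfl⟩
    · rw [aux_Modd q k μ hμ, mul_zero]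
    · exact absurd ⟨k, rfl⟩ hn

/-- Kullback–Leibler divergence of a von Mises–Fisher distribution from the
uniform distribution on the sphere. -/
theorem kl_divergence_vmf_uniform (p : ℕ) (hp : 2 ≤ p)
    (κy : ℝ) (hκy : 0 < κy)
    (μy : EuclideanSpace ℝ (Fin p)) (hμy : ‖μy‖ = 1) :
    klDivUniform p κy μy
      = nuOf p * Real.log (κy / 2) - Real.log (besselI (nuOf p) κy)
        - Real.log (Real.Gamma (nuOf p + 1)) + besselRatio (nuOf p) κy * κy := by
  obtain ⟨q, rfl⟩ : ∃ q, p = q + 1 := ⟨p - 1, by omega⟩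
  have hfin := aux_finite (q+1)
  have hZ := aux_Z q κy μy hμy
  have hW := aux_W q κy μy hμy
  set ν := nuOf (q+1) with hν
  set Z := ∫ s : Metric.sphere (0 : EuclideanSpace ℝ (Fin (q+1))) 1,
    Real.exp (κy * ⟪μy, (s : EuclideanSpace ℝ (Fin (q+1)))⟫) ∂(sphereMeasure (q+1)) with hZdef
  set W := ∫ s : Metric.sphere (0 : EuclideanSpace ℝ (Fin (q+1))) 1,
    ⟪μy, (s : EuclideanSpace ℝ (Fin (q+1)))⟫ *
    Real.exp (κy * ⟪μy, (s : EuclideanSpace ℝ (Fin (q+1)))⟫) ∂(sphereMeasure (q+1)) with hWdef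
  have hc : 0 < 2 * π ^ (ν + 1) := by positivity
  have hGpos : ∀ k : ℕ, 0 < Real.Gamma (ν + k + 1) := fun k =>
    Real.Gamma_pos_of_pos (aux_nu_pos q k)
  have hΓ : 0 < Real.Gamma (ν + 1) := by simpa using hGpos 0
  have hS0 : 0 < ∑' k : ℕ, (κy / 2) ^ (2 * k) / (Nat.factorial k * Real.Gamma (ν + k + 1)) := by
    have hs : Summable fun k : ℕ =>
        (κy / 2) ^ (2 * k) / (Nat.factorial k * Real.Gamma (ν + k + 1)) :=
      (summable_mul_right_iff hc.ne').1 hZ.summable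
    refine hs.tsum_pos (fun k => ?_) 0 ?_
    · have := hGpos k
      positivity
    · have := hGpos 0
      positivity
  have hZe := hZ.tsum_eq
  have hWe := hW.tsum_eq
  rw [tsum_mul_right] at hZe hWe
  set S0 := ∑' k : ℕ, (κy / 2) ^ (2 * k) / (Nat.factorial k * Real.Gamma (ν + k + 1)) with hS0d
  set S1 := ∑' k : ℕ, (κy / 2) ^ (2 * k) / (Nat.factorial k * Real.Gamma (ν + 1 + k + 1)) with hS1d
  have hI0 : besselI ν κy = (κy / 2) ^ ν * S0 := rfl
  have hI1 : besselI (ν + 1) κy = (κy / 2) ^ ν * (κy / 2) * S1 := by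
    rw [← Real.rpow_add_one (by positivity)]; rfl
  have hhalf : 0 < (κy / 2) ^ ν := by positivity
  have hratio : besselRatio ν κy = W / Z := by
    unfold besselRatio
    rw [hI0, hI1, ← hZe, ← hWe]
    field_simp
  have hZpos : 0 < Z := by rw [← hZe]; positivity
  have hC : vmfC ν κy = Z := by
    unfold vmfC
    rw [hI0, ← hZe, Real.div_rpow hκy.le (by norm_num), Real.mul_rpow (by norm_num) pi_pos.le,
      Real.rpow_add_one (by norm_num : (2:ℝ) ≠ 0)]
    have h1 : 0 < κy ^ ν := by positivity
    have h2 : (0:ℝ) < 2 ^ ν := by positivity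
    field_simp
  have hu : 0 < uniformDensity (q+1) := by
    unfold uniformDensity
    rw [← hν]; positivity
  have hcont : Continuous fun s : Metric.sphere (0 : EuclideanSpace ℝ (Fin (q+1))) 1 =>
      ⟪μy, (s : EuclideanSpace ℝ (Fin (q+1)))⟫ := by fun_prop
  have hbd : ∀ f : Metric.sphere (0 : EuclideanSpace ℝ (Fin (q+1))) 1 → ℝ, Continuous f →
      Integrable f (sphereMeasure (q+1)) := fun f hf =>
    hf.integrable_of_hasCompactSupport (HasCompactSupport.of_compactSpace f)
  have hkl : klDivUniform (q+1) κy μy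
      = κy / Z * W - (Real.log Z + Real.log (uniformDensity (q+1))) / Z * Z := by
    unfold klDivUniform
    rw [hWdef]
    conv_rhs => rw [hZdef]
    rw [← hZdef, ← integral_const_mul]
    conv_rhs => 
      enter [2]
      rw [hZdef]
    rw [← hZdef, ← integral_const_mul, ← integral_sub]
    · refine integral_congr_ae (Filter.Eventually.of_forall fun s => ?_)
      simp only [vmf]
      rw [← hν, hC, Real.log_div (by positivity) hu.ne', Real.log_div (by positivity) hZpos.ne',
        Real.log_exp]
      ring
    · exact hbd _ (by fun_prop)
    · exact hbd _ (by fun_prop)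
  have hlogZ : Real.log Z = Real.log (besselI ν κy) - ν * Real.log (κy / 2)
      + Real.log (2 * π ^ (ν + 1)) := by
    rw [hI0, ← hZe, Real.log_mul hS0.ne' hc.ne', Real.log_mul hhalf.ne' hS0.ne',
      Real.log_rpow (by positivity)]
    ring
  have hlogu : Real.log (uniformDensity (q+1)) =
      Real.log (Real.Gamma (ν + 1)) - Real.log (2 * π ^ (ν + 1)) := by
    unfold uniformDensity
    rw [← hν, Real.log_div hΓ.ne' hc.ne']
  rw [hkl, div_mul_cancel₀ _ hZpos.ne', hratio, hlogZ, hlogu]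
  ring
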